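/- Let E̲ ∈ ℝ, let J be a countable index set with gaps (E_j^-, E_j^+), j ∈ J, pairwise disjoint, E̲ ≤ E_j^-, and suppose Σ_{j∈J} γ_j (1 + η_{j,0}^n) < ∞ for a fixed positive integer n. Then there exists a constant M₁ < ∞ such that for every φ ∈ 𝒟 = (ℝ/2πℤ)^J and every integer m with 1 ≤ m ≤ n, |R_m(φ)| ≤ M₁. -/

import Mathlib

open scoped BigOperators

/-- The Dirichlet eigenvalue `μ_j(φ) = E_j^- + γ_j cos²(φ_j/2)`, written using
`cos²(θ/2) = (1 + cos θ)/2` so that it is well defined on the torus `(ℝ/2πℤ)^J`. -/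
noncomputable def gapMu {J : Type*} (Em Ep : J → ℝ) (φ : J → Real.Angle) (j : J) : ℝ :=
  Em j + (Ep j - Em j) * (1 + (φ j).cos) / 2

/-- The scalar field `Q_k(φ) = E̲^k + Σ_j ((E_j^-)^k + (E_j^+)^k − 2 μ_j(φ)^k)`. -/
noncomputable def Qfield {J : Type*} (Ebot : ℝ) (Em Ep : J → ℝ) (k : ℕ)
    (φ : J → Real.Angle) : ℝ :=
  Ebot ^ k + ∑' j, (Em j ^ k + Ep j ^ k - 2 * gapMu Em Ep φ j ^ k)

/-- The scalar field
`R_m = Σ_{α : Σ k α_k = m} Π_k Q_k^{α_k} / (α_k! (2k)^{α_k})` (so `R_0 = 1`). -/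
noncomputable def Rfield {J : Type*} (Ebot : ℝ) (Em Ep : J → ℝ) (m : ℕ)
    (φ : J → Real.Angle) : ℝ :=
  ∑ α ∈ (Fintype.piFinset fun _ : Fin m => Finset.range (m + 1)).filter
      (fun α => ∑ i, (i.1 + 1) * α i = m),
    ∏ i, Qfield Ebot Em Ep (i.1 + 1) φ ^ α i /
      (((α i).factorial * (2 * (i.1 + 1)) ^ α i : ℕ) : ℝ)

/-- An increment of `x ↦ x ^ k` between two points of the interval `[a, a + G]` with `e ≤ a` is
controlled by the length of the increment times `1 + (a - e) ^ n`, for all `k ≤ n`. -/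
theorem abs_pow_sub_pow_le_of_le_add {e G a x y : ℝ} {k n : ℕ} (hkn : k ≤ n) (hG : 0 ≤ G)
    (hea : e ≤ a) (hax : a ≤ x) (hxG : x ≤ a + G) (hay : a ≤ y) (hyG : y ≤ a + G) :
    |x ^ k - y ^ k| ≤ |x - y| * (n * ((|e| + G + 1) ^ n * 2 ^ n) * (1 + (a - e) ^ n)) := by
  have hη : 0 ≤ a - e := sub_nonneg.2 hea
  have hA : 0 ≤ |e| + G := by positivity
  have habs : ∀ z, a ≤ z → z ≤ a + G → |z| ≤ (|e| + G + 1) * (1 + (a - e)) := by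
    intro z hz hzG
    have h1 := neg_abs_le e
    have h2 := le_abs_self e
    have h3 := mul_nonneg hA hη
    exact abs_le.2 ⟨by linarith, by linarith⟩
  have hone : 1 ≤ (|e| + G + 1) * (1 + (a - e)) := by
    have := mul_nonneg hA hη
    linarith
  have hpow : max |x| |y| ^ (k - 1) ≤ (|e| + G + 1) ^ n * 2 ^ n * (1 + (a - e) ^ n) := by
    calc max |x| |y| ^ (k - 1)
        ≤ ((|e| + G + 1) * (1 + (a - e))) ^ (k - 1) := by
          gcongr
          exact max_le (habs x hax hxG) (habs y hay hyG)
      _ ≤ ((|e| + G + 1) * (1 + (a - e))) ^ n := pow_le_pow_right₀ hone (by omega)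
      _ = (|e| + G + 1) ^ n * (1 + (a - e)) ^ n := mul_pow _ _ _
      _ ≤ (|e| + G + 1) ^ n * (2 ^ (n - 1) * (1 ^ n + (a - e) ^ n)) := by
          gcongr
          exact add_pow_le zero_le_one hη n
      _ ≤ (|e| + G + 1) ^ n * (2 ^ n * (1 ^ n + (a - e) ^ n)) := by
          gcongr
          · norm_num
          · omega
      _ = (|e| + G + 1) ^ n * 2 ^ n * (1 + (a - e) ^ n) := by
          rw [one_pow, mul_assoc]
  calc |x ^ k - y ^ k| ≤ |x - y| * k * max |x| |y| ^ (k - 1) := abs_pow_sub_pow_le x y k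
    _ ≤ |x - y| * n * ((|e| + G + 1) ^ n * 2 ^ n * (1 + (a - e) ^ n)) := by gcongr
    _ = |x - y| * (n * ((|e| + G + 1) ^ n * 2 ^ n) * (1 + (a - e) ^ n)) := by ring

theorem gapMu_mem_Icc {J : Type*} {Em Ep : J → ℝ} (hle : ∀ j, Em j ≤ Ep j)
    (φ : J → Real.Angle) (j : J) : gapMu Em Ep φ j ∈ Set.Icc (Em j) (Ep j) := by
  have hγ := sub_nonneg.2 (hle j)
  have hcos : |(φ j).cos| ≤ 1 := by
    induction φ j using Real.Angle.induction_on with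
    | _ x => simpa using Real.abs_cos_le_one x
  have h1 := mul_nonneg hγ (neg_le_iff_add_nonneg'.1 (abs_le.1 hcos).1)
  have h2 := mul_nonneg hγ (sub_nonneg.2 (abs_le.1 hcos).2)
  constructor <;> unfold gapMu <;> linarith

/-- Under the moment condition of order `n`, the fields `Q_k`, `k ≤ n`, are uniformly bounded. -/
theorem exists_abs_Qfield_le {J : Type*} (Ebot : ℝ) (Em Ep : J → ℝ)
    (hle : ∀ j, Em j ≤ Ep j) (hbot : ∀ j, Ebot ≤ Em j) (n : ℕ)
    (hmom : Summable fun j => (Ep j - Em j) * (1 + (Em j - Ebot) ^ n)) :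
    ∃ B : ℝ, 0 ≤ B ∧ ∀ φ : J → Real.Angle, ∀ k ≤ n, |Qfield Ebot Em Ep k φ| ≤ B := by
  have hγ : ∀ j, 0 ≤ Ep j - Em j := fun j => sub_nonneg.2 (hle j)
  have hη : ∀ j, 0 ≤ (Em j - Ebot) ^ n := fun j => pow_nonneg (sub_nonneg.2 (hbot j)) n
  have hterm : ∀ j, 0 ≤ (Ep j - Em j) * (1 + (Em j - Ebot) ^ n) := fun j =>
    mul_nonneg (hγ j) (by linarith [hη j])
  set G := ∑' j, (Ep j - Em j) * (1 + (Em j - Ebot) ^ n) with hGdef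
  have hG : 0 ≤ G := tsum_nonneg hterm
  have hγG : ∀ j, Ep j ≤ Em j + G := fun j => by
    have h1 := hmom.le_tsum j fun i _ => hterm i
    have h2 := mul_nonneg (hγ j) (hη j)
    linarith
  set C : ℝ := n * ((|Ebot| + G + 1) ^ n * 2 ^ n) with hC
  have hC0 : 0 ≤ C := by positivity
  refine ⟨(1 + |Ebot|) ^ n + 2 * C * G, by positivity, fun φ k hk => ?_⟩
  have hsum : |∑' j, (Em j ^ k + Ep j ^ k - 2 * gapMu Em Ep φ j ^ k)| ≤ 2 * C * G := by
    rw [← Real.norm_eq_abs]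
    refine tsum_of_norm_bounded (hmom.hasSum.mul_left (2 * C)) fun j => ?_
    obtain ⟨hμ1, hμ2⟩ := gapMu_mem_Icc hle φ j
    have key : ∀ x, Em j ≤ x → x ≤ Ep j → |x ^ k - gapMu Em Ep φ j ^ k| ≤
        (Ep j - Em j) * (C * (1 + (Em j - Ebot) ^ n)) := by
      intro x hx1 hx2
      refine (abs_pow_sub_pow_le_of_le_add hk hG (hbot j) hx1 (hx2.trans (hγG j)) hμ1
        (hμ2.trans (hγG j))).trans ?_
      refine mul_le_mul_of_nonneg_right (abs_le.2 ⟨by linarith, by linarith⟩) ?_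
      exact mul_nonneg hC0 (by linarith [hη j])
    calc |Em j ^ k + Ep j ^ k - 2 * gapMu Em Ep φ j ^ k|
        = |(Em j ^ k - gapMu Em Ep φ j ^ k) + (Ep j ^ k - gapMu Em Ep φ j ^ k)| := by
          congr 1
          ring
      _ ≤ |Em j ^ k - gapMu Em Ep φ j ^ k| + |Ep j ^ k - gapMu Em Ep φ j ^ k| := abs_add_le _ _
      _ ≤ 2 * C * ((Ep j - Em j) * (1 + (Em j - Ebot) ^ n)) := by
          linarith [key _ le_rfl (hle j), key _ (hle j) le_rfl]
  have hE : |Ebot ^ k| ≤ (1 + |Ebot|) ^ n := by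
    rw [abs_pow]
    calc |Ebot| ^ k ≤ (1 + |Ebot|) ^ k := by
          gcongr
          linarith
      _ ≤ (1 + |Ebot|) ^ n := pow_le_pow_right₀ (by linarith [abs_nonneg Ebot]) hk
  exact (abs_add_le _ _).trans (add_le_add hE hsum)

/-- A bound `B` on the fields `Q_k`, `1 ≤ k ≤ m`, gives a bound on `R_m` depending only on `B`
and `m`. -/
theorem abs_Rfield_le {J : Type*} {Ebot B : ℝ} {Em Ep : J → ℝ} {m : ℕ} {φ : J → Real.Angle}
    (hQ : ∀ k ≤ m, |Qfield Ebot Em Ep k φ| ≤ B) :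
    |Rfield Ebot Em Ep m φ| ≤
      ∑ α ∈ (Fintype.piFinset fun _ : Fin m => Finset.range (m + 1)).filter
        (fun α => ∑ i, (i.1 + 1) * α i = m), ∏ i, B ^ α i := by
  refine (Finset.abs_sum_le_sum_abs _ _).trans (Finset.sum_le_sum fun α _ => ?_)
  rw [Finset.abs_prod]
  refine Finset.prod_le_prod (fun _ _ => abs_nonneg _) fun i _ => ?_
  rw [abs_div, abs_pow, Nat.abs_cast]
  refine (div_le_self (by positivity) ?_).trans
    (pow_le_pow_left₀ (abs_nonneg _) (hQ _ i.2) _)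
  exact Nat.one_le_cast.2 (Nat.succ_le_of_lt (by positivity))

/-- Under the moment condition `Σ γ_j (1 + η_{j,0}^n) < ∞`, the scalar fields `R_m`,
`1 ≤ m ≤ n`, are uniformly bounded on the torus of Dirichlet data. -/
theorem Rm_bounded {J : Type*} [Countable J] (Ebot : ℝ) (Em Ep : J → ℝ)
    (hlt : ∀ j, Em j < Ep j) (hbot : ∀ j, Ebot ≤ Em j)
    (hdisj : ∀ i j, i ≠ j → Disjoint (Set.Ioo (Em i) (Ep i)) (Set.Ioo (Em j) (Ep j)))
    (n : ℕ) (hn : 1 ≤ n)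
    (hmom : Summable fun j => (Ep j - Em j) * (1 + (Em j - Ebot) ^ n)) :
    ∃ M₁ : ℝ, ∀ φ : J → Real.Angle, ∀ m : ℕ, 1 ≤ m → m ≤ n →
      |Rfield Ebot Em Ep m φ| ≤ M₁ := by
  obtain ⟨B, hB, hQ⟩ := exists_abs_Qfield_le Ebot Em Ep (fun j => (hlt j).le) hbot n hmom
  refine ⟨∑ m ∈ Finset.range (n + 1),
    ∑ α ∈ (Fintype.piFinset fun _ : Fin m => Finset.range (m + 1)).filter
      (fun α => ∑ i, (i.1 + 1) * α i = m), ∏ i, B ^ α i, fun φ m _ hm => ?_⟩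
  refine (abs_Rfield_le fun k hk => hQ φ k (hk.trans hm)).trans ?_
  exact Finset.single_le_sum (f := fun m : ℕ =>
    ∑ α ∈ (Fintype.piFinset fun _ : Fin m => Finset.range (m + 1)).filter
      (fun α => ∑ i, (i.1 + 1) * α i = m), ∏ i, B ^ α i)
    (fun m _ => Finset.sum_nonneg fun α _ => Finset.prod_nonneg fun i _ => pow_nonneg hB _)
    (Finset.mem_range.2 (Nat.lt_succ_of_le hm))
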